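/- arXiv:2304.08696 — 2 statements merged into one kernel-verified Lean document; each statement's English description precedes it below -/
import Mathlib

section
/- Let U_s : [0,∞) → ℝ be twice differentiable, c ∈ ℂ, α ∈ ℝ, and let φ : [0,∞) → ℂ be twice differentiable at a point y ≥ 0 with U_s(y) ≠ conj(c). Then (Ray*_c φ)(y) = (1/(U_s(y) − conj(c))) · conj( Ray_c((U_s − c)·(conj∘φ))(y) ), where conj∘φ denotes the pointwise complex conjugate of φ. -/
open MeasureTheory Filter Set

noncomputable section

/-- `Δ_α φ = φ'' − α² φ`. -/
def DeltaA (α : ℝ) (φ : ℝ → ℂ) : ℝ → ℂ :=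
  fun y => deriv (deriv φ) y - (α : ℂ) ^ 2 * φ y

/-- The Rayleigh operator `Ray_c φ = (U − c) Δ_α φ − U'' φ`. -/
def Ray (U : ℝ → ℝ) (α : ℝ) (c : ℂ) (φ : ℝ → ℂ) : ℝ → ℂ :=
  fun y => ((U y : ℂ) - c) * DeltaA α φ y - ((deriv (deriv U) y : ℝ) : ℂ) * φ y

/-- The adjoint Rayleigh operator `Ray*_c φ = (U − conj c) Δ_α φ + 2 U' φ'`. -/
def RayStar (U : ℝ → ℝ) (α : ℝ) (c : ℂ) (φ : ℝ → ℂ) : ℝ → ℂ :=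
  fun y => ((U y : ℂ) - (starRingEnd ℂ) c) * DeltaA α φ y + 2 * ((deriv U y : ℝ) : ℂ) * deriv φ y

/-- A shear flow with decay rate `η₀`: smooth, bounded, vanishing at the origin with its
first two derivatives, with a finite limit at `+∞` and exponentially decaying derivatives. -/
def ShearFlow (U : ℝ → ℝ) (η₀ : ℝ) : Prop :=
  ContDiff ℝ (⊤ : ℕ∞) U ∧ (∃ M : ℝ, ∀ y : ℝ, |U y| ≤ M) ∧ U 0 = 0 ∧ deriv U 0 = 0 ∧
    deriv (deriv U) 0 = 0 ∧ (∃ L : ℝ, Tendsto U atTop (nhds L)) ∧ 0 < η₀ ∧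
    (∀ k : ℕ, 1 ≤ k → ∃ C : ℝ, 0 < C ∧ ∀ y : ℝ, 0 ≤ y →
      |iteratedDeriv k U y| ≤ C * Real.exp (-η₀ * y))

/-- pointwise identity relating the adjoint Rayleigh operator to the
Rayleigh operator applied to `(U − c)·conj φ`. -/
theorem stmt_2 (U : ℝ → ℝ) (hU1 : ∀ x : ℝ, DifferentiableAt ℝ U x)
    (hU2 : ∀ x : ℝ, DifferentiableAt ℝ (deriv U) x)
    (c : ℂ) (α : ℝ) (φ : ℝ → ℂ) (y : ℝ) (hy : 0 ≤ y)
    (hφ1 : ∀ᶠ x in nhds y, DifferentiableAt ℝ φ x)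
    (hφ2 : DifferentiableAt ℝ (deriv φ) y)
    (hUy : (U y : ℂ) ≠ (starRingEnd ℂ) c) :
    RayStar U α c φ y =
      ((U y : ℂ) - (starRingEnd ℂ) c)⁻¹ *
        (starRingEnd ℂ)
          (Ray U α c (fun x => ((U x : ℂ) - c) * (starRingEnd ℂ) (φ x)) y) := by
  have hofr : ∀ {f : ℝ → ℝ} {x : ℝ}, DifferentiableAt ℝ f x →
      HasDerivAt (fun t => (f t : ℂ)) ((deriv f x : ℝ) : ℂ) x :=
    fun h => h.hasDerivAt.ofReal_comp
  have hconj : ∀ {f : ℝ → ℂ} {x : ℝ}, DifferentiableAt ℝ f x →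
      HasDerivAt (fun t => (starRingEnd ℂ) (f t)) ((starRingEnd ℂ) (deriv f x)) x :=
    fun h => h.hasDerivAt.star
  have h1 : deriv (fun x => ((U x : ℂ) - c) * (starRingEnd ℂ) (φ x)) =ᶠ[nhds y]
      fun x => ((deriv U x : ℝ) : ℂ) * (starRingEnd ℂ) (φ x)
        + ((U x : ℂ) - c) * (starRingEnd ℂ) (deriv φ x) := by
    filter_upwards [hφ1] with x hx
    exact (((hofr (hU1 x)).sub_const c).mul (hconj hx)).deriv
  have h2 := h1.deriv_eq
  have h3 := (((hofr (hU2 y)).mul (hconj hφ1.self_of_nhds)).add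
    (((hofr (hU1 y)).sub_const c).mul (hconj hφ2))).deriv
  have h4 := h2.trans h3
  have hne : (U y : ℂ) - (starRingEnd ℂ) c ≠ 0 := sub_ne_zero.mpr hUy
  rw [eq_inv_mul_iff_mul_eq₀ hne]
  simp only [RayStar, Ray, DeltaA, h4, map_sub, map_mul, map_add, map_pow, Complex.conj_conj,
    Complex.conj_ofReal]
  ring
end
end

section
/- Let U_s : [0,∞) → ℝ be differentiable, c₀ ∈ ℂ with U_s(y) ∉ {c₀, conj(c₀)} for all y ≥ 0, and let φ⁻, φ⁺ : [0,∞) → ℂ be differentiable with constant nonzero Wronskian J := φ⁻(φ⁺)' − φ⁺(φ⁻)'. Define ψ^± := (conj∘φ^±)/(U_s − conj(c₀)) and J*(x) := ψ⁻(x)(ψ⁺)'(x) − ψ⁺(x)(ψ⁻)'(x). Then J*(x) ≠ 0 for all x ≥ 0, and for all x ≥ 0 one has conj( −ψ⁻(x)·ψ⁺(0) / ((U_s(x) − conj(c₀))·J*(x)) ) = (−conj(ψ⁺(0))/J)·φ⁻(x); in particular the function x ↦ conj(G^I_{c₀}(x,0)), with G^I_{c₀}(x,0) := −ψ⁻(x)ψ⁺(0)/((U_s(x)−conj(c₀))J*(x)),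 is a constant multiple of φ⁻. -/
open MeasureTheory Filter Set

noncomputable section

/-- if `φ⁻, φ⁺` have constant nonzero Wronskian `J`, then the Wronskian `J*`
of `ψ^± = conj(φ^±)/(U − conj c₀)` never vanishes on `[0,∞)`, and
`conj(−ψ⁻(x)ψ⁺(0)/((U(x)−conj c₀) J*(x))) = (−conj(ψ⁺(0))/J)·φ⁻(x)`; in particular
`x ↦ conj (G^I_{c₀}(x,0))` is a constant multiple of `φ⁻`. -/
theorem stmt_10 (U : ℝ → ℝ) (hU : ∀ x : ℝ, DifferentiableAt ℝ U x) (c₀ : ℂ)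
    (hc : ∀ y : ℝ, 0 ≤ y → (U y : ℂ) ≠ c₀ ∧ (U y : ℂ) ≠ (starRingEnd ℂ) c₀)
    (φm φp : ℝ → ℂ)
    (hφm : ∀ x : ℝ, DifferentiableAt ℝ φm x) (hφp : ∀ x : ℝ, DifferentiableAt ℝ φp x)
    (J : ℂ) (hJ : J ≠ 0)
    (hW : ∀ x : ℝ, 0 ≤ x → φm x * deriv φp x - φp x * deriv φm x = J)
    (ψm ψp : ℝ → ℂ)
    (hψm : ψm = fun y => (starRingEnd ℂ) (φm y) / ((U y : ℂ) - (starRingEnd ℂ) c₀))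
    (hψp : ψp = fun y => (starRingEnd ℂ) (φp y) / ((U y : ℂ) - (starRingEnd ℂ) c₀))
    (Jstar : ℝ → ℂ)
    (hJstar : Jstar = fun x => ψm x * deriv ψp x - ψp x * deriv ψm x) :
    ∀ x : ℝ, 0 ≤ x →
      Jstar x ≠ 0 ∧
      (starRingEnd ℂ)
          (-(ψm x * ψp 0) / (((U x : ℂ) - (starRingEnd ℂ) c₀) * Jstar x)) =
        (-(starRingEnd ℂ) (ψp 0) / J) * φm x := by
  intro x hx
  have hD : (U x : ℂ) - (starRingEnd ℂ) c₀ ≠ 0 := sub_ne_zero.mpr (hc x hx).2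
  have hUd : HasDerivAt (fun y => (U y : ℂ) - (starRingEnd ℂ) c₀) ((deriv U x : ℝ) : ℂ) x :=
    ((hU x).hasDerivAt.ofReal_comp).sub_const _
  have hm : HasDerivAt (fun y => (starRingEnd ℂ) (φm y)) ((starRingEnd ℂ) (deriv φm x)) x :=
    (hφm x).hasDerivAt.star
  have hp : HasDerivAt (fun y => (starRingEnd ℂ) (φp y)) ((starRingEnd ℂ) (deriv φp x)) x :=
    (hφp x).hasDerivAt.star
  have dm := (hm.fun_div hUd hD).deriv
  have dp := (hp.fun_div hUd hD).deriv
  have hcJ : (starRingEnd ℂ) J ≠ 0 := (map_ne_zero _).mpr hJ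
  have hWc := congrArg (starRingEnd ℂ) (hW x hx)
  simp only [map_sub, map_mul] at hWc
  have key : Jstar x = (starRingEnd ℂ) J / ((U x : ℂ) - (starRingEnd ℂ) c₀) ^ 2 := by
    rw [hJstar, hψm, hψp]
    simp only []
    rw [dm, dp, ← hWc]
    field_simp
    ring
  refine ⟨?_, ?_⟩
  · rw [key]
    exact div_ne_zero hcJ (pow_ne_zero 2 hD)
  · have h2 : -(ψm x * ψp 0) / (((U x : ℂ) - (starRingEnd ℂ) c₀) * Jstar x)
        = -(ψp 0) / (starRingEnd ℂ) J * (starRingEnd ℂ) (φm x) := by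
      have hx' : ψm x = (starRingEnd ℂ) (φm x) / ((U x : ℂ) - (starRingEnd ℂ) c₀) := by rw [hψm]
      rw [key, hx']
      generalize ψp 0 = a
      field_simp
    rw [h2]
    simp only [map_mul, map_div₀, map_neg, Complex.conj_conj]
end
end
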